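/- arXiv:2601.01681 — 3 statements merged into one kernel-verified Lean document; each statement's English description precedes it below -/
import Mathlib

section
/- For every median algebra X, the independence number of the family ℋ(X) of all halfspaces of X equals the rank of X: ind(ℋ(X)) = rank(X), as elements of ℕ ∪ {∞}. -/
open Set

/-- A median algebra: a ternary operation invariant under permutations of its
arguments, with `m x y y = y` and the standard associativity law. -/
structure MedianStruct (X : Type*) where
  med : X → X → X → X
  med_perm : ∀ (σ : Equiv.Perm (Fin 3)) (v : Fin 3 → X),
    med (v (σ 0)) (v (σ 1)) (v (σ 2)) = med (v 0) (v 1) (v 2)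
  med_idem : ∀ x y : X, med x y y = y
  med_assoc : ∀ x y z u w : X,
    med (med x y z) u w = med x (med y u w) (med z u w)

namespace MedianStruct

variable {X : Type*}

/-- The interval `[x,y] = {z | m x y z = z}`. -/
def interval (M : MedianStruct X) (x y : X) : Set X := {z | M.med x y z = z}

/-- A set is convex if it contains the interval between any two of its points. -/
def IsConvex (M : MedianStruct X) (C : Set X) : Prop :=
  ∀ x ∈ C, ∀ y ∈ C, M.interval x y ⊆ C

/-- A halfspace: a convex set with convex complement. -/
def IsHalfspace (M : MedianStruct X) (H : Set X) : Prop :=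
  M.IsConvex H ∧ M.IsConvex Hᶜ

end MedianStruct

/-- Two sets are crossing if all four intersections of them/their complements
are nonempty. -/
def Crossing {X : Type*} (A B : Set X) : Prop :=
  (A ∩ B).Nonempty ∧ (A ∩ Bᶜ).Nonempty ∧ (Aᶜ ∩ B).Nonempty ∧ (Aᶜ ∩ Bᶜ).Nonempty

/-- A finite family of sets is (Rosenthal) independent. -/
def IndepSetFamily {X : Type*} {k : ℕ} (A : Fin k → Set X) : Prop :=
  ∀ P M : Finset (Fin k), Disjoint P M →
    ((⋂ i ∈ P, A i) ∩ ⋂ j ∈ M, (A j)ᶜ).Nonempty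

/-- The independence number of a family of sets: the supremum of the sizes of
independent finite subfamilies. -/
noncomputable def indSets {X : Type*} (𝒞 : Set (Set X)) : ℕ∞ :=
  ⨆ (k : ℕ) (_ : ∃ A : Fin k → Set X,
      (∀ i, A i ∈ 𝒞) ∧ Function.Injective A ∧ IndepSetFamily A), (k : ℕ∞)

/-- Majority (median) operation on `Bool`. -/
def boolMed (a b c : Bool) : Bool := (a && b) || (b && c) || (a && c)

/-- The coordinatewise majority median on a power of `Bool`. -/
def boolCubeMed (I : Type*) : MedianStruct (I → Bool) where
  med x y z := fun i => boolMed (x i) (y i) (z i)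
  med_perm σ v := by
    funext i
    exact (by decide :
      ∀ (τ : Equiv.Perm (Fin 3)) (w : Fin 3 → Bool),
        boolMed (w (τ 0)) (w (τ 1)) (w (τ 2)) = boolMed (w 0) (w 1) (w 2))
      σ (fun j => v j i)
  med_idem x y := by
    funext i
    exact (by decide : ∀ a b : Bool, boolMed a b b = b) (x i) (y i)
  med_assoc x y z u w := by
    funext i
    exact (by decide : ∀ a b c d e : Bool,
        boolMed (boolMed a b c) d e = boolMed a (boolMed b d e) (boolMed c d e))
      (x i) (y i) (z i) (u i) (w i)

/-- A median-preserving (MP) map between median algebras. -/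
def IsMedianHom {X Y : Type*} (M : MedianStruct X) (N : MedianStruct Y)
    (f : X → Y) : Prop :=
  ∀ x y z, f (M.med x y z) = N.med (f x) (f y) (f z)

/-- The rank of a median algebra: the supremum of the `n` such that the Boolean
hypercube `{0,1}ⁿ` embeds into it by an injective median-preserving map. -/
noncomputable def medRank {X : Type*} (M : MedianStruct X) : ℕ∞ :=
  ⨆ (n : ℕ) (_ : ∃ f : (Fin n → Bool) → X,
      Function.Injective f ∧ IsMedianHom (boolCubeMed (Fin n)) M f), (n : ℕ∞)

/-- The median operation on `ℝ`. -/
noncomputable def realMed (a b c : ℝ) : ℝ := max (max (min a b) (min b c)) (min a c)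

/-- A real-valued median-preserving function on a median algebra. -/
def IsMedianPreserving {X : Type*} (M : MedianStruct X) (f : X → ℝ) : Prop :=
  ∀ x y z, f (M.med x y z) = realMed (f x) (f y) (f z)

/-- A finite sequence of real functions is independent with witnessing
constants `a < b`. -/
def IndepFunFinWith {X : Type*} {k : ℕ} (f : Fin k → X → ℝ) (a b : ℝ) : Prop :=
  ∀ P M : Finset (Fin k), Disjoint P M →
    ((⋂ i ∈ P, {x | f i x ≤ a}) ∩ ⋂ j ∈ M, {x | b ≤ f j x}).Nonempty

/-- A finite sequence of real functions is independent. -/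
def IndepFunFin {X : Type*} {k : ℕ} (f : Fin k → X → ℝ) : Prop :=
  ∃ a b : ℝ, a < b ∧ IndepFunFinWith f a b

/-- The independence number of a family of real functions: the supremum of the
lengths of independent finite sequences in the family. -/
noncomputable def indFun {X : Type*} (F : Set (X → ℝ)) : ℕ∞ :=
  ⨆ (k : ℕ) (_ : ∃ f : Fin k → X → ℝ, (∀ i, f i ∈ F) ∧ IndepFunFin f), (k : ℕ∞)

/-- An infinite sequence of real functions is independent. -/
def IndepFunSeq {X : Type*} (f : ℕ → X → ℝ) : Prop :=
  ∃ a b : ℝ, a < b ∧ ∀ P M : Finset ℕ, Disjoint P M →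
    ((⋂ i ∈ P, {x | f i x ≤ a}) ∩ ⋂ j ∈ M, {x | b ≤ f j x}).Nonempty

/-- A finite set `S` is shattered by a family of sets `𝒟`. -/
def Shatters {Y : Type*} (𝒟 : Set (Set Y)) (S : Finset Y) : Prop :=
  ∀ T : Set Y, T ⊆ ↑S → ∃ D ∈ 𝒟, D ∩ ↑S = T

/-- The VC-dimension of a family of sets. -/
noncomputable def vcDim {Y : Type*} (𝒟 : Set (Set Y)) : ℕ∞ :=
  ⨆ (k : ℕ) (_ : ∃ S : Finset Y, S.card = k ∧ Shatters 𝒟 S), (k : ℕ∞)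

/-- The dual set system of `𝒞`: on the ground set `𝒞`, the sets
`R_x = {C ∈ 𝒞 | x ∈ C}` for `x ∈ X`. -/
def dualSystem {X : Type*} (𝒞 : Set (Set X)) : Set (Set ↥𝒞) :=
  {R | ∃ x : X, R = {C : ↥𝒞 | x ∈ (C : Set X)}}

/-- The family of all continuous median-preserving maps `X → [0,1]`. -/
def MCfam {X : Type*} [TopologicalSpace X] (M : MedianStruct X) : Set (X → ℝ) :=
  {f | Continuous f ∧ IsMedianPreserving M f ∧ ∀ x, f x ∈ Set.Icc (0 : ℝ) 1}

namespace MedianStruct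

variable {X : Type*} (M : MedianStruct X)

lemma med_swap_left (x y z : X) : M.med x y z = M.med y x z := by
  have h := M.med_perm (Equiv.swap 0 1) ![y, x, z]
  rw [Equiv.swap_apply_of_ne_of_ne (x := 2) (by decide) (by decide)] at h
  simpa using h

lemma med_swap_right (x y z : X) : M.med x y z = M.med x z y := by
  have h := M.med_perm (Equiv.swap 1 2) ![x, z, y]
  rw [Equiv.swap_apply_of_ne_of_ne (by decide) (by decide)] at h
  simpa using h

lemma med_rotate (x y z : X) : M.med x y z = M.med y z x := by
  rw [M.med_swap_left, M.med_swap_right]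

lemma med_left_left (x y : X) : M.med x x y = x := by
  rw [← M.med_rotate, M.med_idem]

lemma med_left_right (x y : X) : M.med x y x = x := by
  rw [M.med_rotate, M.med_rotate, M.med_left_left]

lemma med_mem_interval (x y z : X) : M.med x y z ∈ M.interval x y := by
  change M.med x y (M.med x y z) = M.med x y z
  have h := M.med_assoc z x y x y
  rwa [M.med_left_left, M.med_left_right, M.med_rotate z x y, M.med_rotate (M.med x y z)] at h

lemma interval_comm (x y : X) : M.interval x y = M.interval y x := by
  ext z
  simp only [interval, Set.mem_ofPred_eq, M.med_swap_left x y]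

lemma left_mem_interval (x y : X) : x ∈ M.interval x y := M.med_left_right x y

lemma right_mem_interval (x y : X) : y ∈ M.interval x y := M.med_idem x y

variable {M}

lemma mem_interval_of_mem_interval_left {x y z w : X} (hz : z ∈ M.interval x y)
    (hw : w ∈ M.interval x z) : z ∈ M.interval w y := by
  change M.med w y z = z
  have hz' : M.med x y z = z := hz
  have hw' : M.med w x z = w := (M.med_rotate w x z).trans hw
  calc M.med w y z = M.med (M.med w x z) y z := by rw [hw']
    _ = z := by rw [M.med_assoc, hz', M.med_left_right, M.med_idem]

/-- Taking the median with fixed `z` and `p` is monotone with respect to the basepoint `p`. -/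
lemma med_mem_interval_of_mem_interval {x c p : X} (z : X) (hx : x ∈ M.interval c p) :
    M.med p c z ∈ M.interval (M.med x p z) z := by
  have hx' : M.med x c p = x := (M.med_rotate x c p).trans hx
  set q := M.med p c z with hq
  have hc : M.med c q z = q := by
    have h := M.med_mem_interval c z p
    rw [← M.med_rotate p c z] at h
    rwa [M.med_swap_right]
  have hp : M.med p q z = q := by
    have h := M.med_mem_interval p z c
    rw [← M.med_swap_right p c z] at h
    rwa [M.med_swap_right]
  have hxq : M.med x q z = q := by
    calc M.med x q z = M.med (M.med x c p) q z := by rw [hx']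
      _ = q := by rw [M.med_assoc, hc, hp, M.med_idem]
  change M.med (M.med x p z) z q = q
  rw [M.med_assoc, M.med_left_left, M.med_swap_right p, hp, hxq]

/-- The union of the intervals joining a point to a convex set is convex. -/
lemma IsConvex.join {C : Set X} (hC : M.IsConvex C) (p : X) :
    M.IsConvex {z | ∃ c ∈ C, z ∈ M.interval c p} := by
  rintro x ⟨c, hc, hx⟩ y ⟨d, hd, hy⟩ z hz
  have hz' : M.med x y z = z := hz
  refine ⟨M.med c d z, hC c hc d hd (M.med_mem_interval c d z), ?_⟩
  have h₀ : z ∈ M.interval (M.med x p z) (M.med y p z) := by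
    change M.med _ _ z = z
    have h := M.med_assoc z x y p z
    rw [M.med_rotate z x y, hz', M.med_left_right] at h
    exact (M.med_rotate z _ _).symm.trans h.symm
  have h₁ := mem_interval_of_mem_interval_left h₀ (med_mem_interval_of_mem_interval z hx)
  rw [interval_comm] at h₁
  have h₂ := mem_interval_of_mem_interval_left h₁ (med_mem_interval_of_mem_interval z hy)
  have h₂' : M.med (M.med p d z) (M.med p c z) z = z := h₂
  change M.med (M.med c d z) p z = z
  rw [← M.med_rotate z c d, M.med_assoc, M.med_rotate, M.med_swap_left c p, M.med_swap_left d p,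
    M.med_swap_left, h₂']

/-- Distinct points of a median algebra are separated by a halfspace. -/
theorem exists_isHalfspace_notMem_mem {a b : X} (hab : a ≠ b) :
    ∃ H, M.IsHalfspace H ∧ a ∉ H ∧ b ∈ H := by
  have hb : ({b} : Set X) ∈ {C | M.IsConvex C ∧ a ∉ C} := by
    refine ⟨?_, hab⟩
    rintro x rfl y rfl z hz
    exact (hz : M.med _ _ z = z).symm.trans (M.med_left_left _ z)
  obtain ⟨C, hbC, hmax⟩ := zorn_subset_nonempty {C | M.IsConvex C ∧ a ∉ C} (by
    intro c hc hchain _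
    refine ⟨⋃₀ c, ⟨?_, ?_⟩, fun s hs => Set.subset_sUnion_of_mem hs⟩
    · rintro x ⟨s, hs, hx⟩ y ⟨t, ht, hy⟩
      rcases hchain.total hs ht with h | h
      · exact ((hc ht).1 x (h hx) y hy).trans (Set.subset_sUnion_of_mem ht)
      · exact ((hc hs).1 x hx y (h hy)).trans (Set.subset_sUnion_of_mem hs)
    · rintro ⟨s, hs, ha⟩
      exact (hc hs).2 ha) {b} hb
  obtain ⟨hC, haC⟩ := hmax.prop
  have hbC : b ∈ C := hbC rfl
  have key : ∀ p ∉ C, ∃ c ∈ C, a ∈ M.interval c p := by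
    intro p hp
    by_contra ha
    have hle := hmax.le_of_ge (y := {z | ∃ c ∈ C, z ∈ M.interval c p})
      ⟨hC.join p, ha⟩ (fun c hc => ⟨c, hc, M.left_mem_interval c p⟩)
    exact hp (hle ⟨b, hbC, M.right_mem_interval b p⟩)
  refine ⟨C, ⟨hC, ?_⟩, haC, hbC⟩
  intro p hp q hq r hr hrC
  obtain ⟨c, hc, hac⟩ := key p hp
  obtain ⟨d, hd, had⟩ := key q hq
  set e := M.med c d a with he
  have heC : e ∈ C := hC c hc d hd (M.med_mem_interval c d a)
  have hep : a ∈ M.interval e p := mem_interval_of_mem_interval_left hac (by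
    rw [he, M.med_swap_right]
    exact M.med_mem_interval c a d)
  have heq : a ∈ M.interval e q := mem_interval_of_mem_interval_left had (by
    rw [he, M.med_rotate]
    exact M.med_mem_interval d a c)
  refine haC (hC r hrC e heC ?_)
  have hr' : M.med r p q = r := (M.med_rotate r p q).trans hr
  have hep' : M.med p e a = a := (M.med_swap_left p e a).trans hep
  have heq' : M.med q e a = a := (M.med_swap_left q e a).trans heq
  change M.med r e a = a
  calc M.med r e a = M.med (M.med r p q) e a := by rw [hr']
    _ = a := by rw [M.med_assoc, hep', heq', M.med_idem]

lemma IsConvex.med_mem {C : Set X} (hC : M.IsConvex C) {x y : X} (hx : x ∈ C) (hy : y ∈ C)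
    (z : X) : M.med x y z ∈ C :=
  hC x hx y hy (M.med_mem_interval x y z)

lemma IsConvex.med_mem_of_two {C : Set X} (hC : M.IsConvex C) {x y z : X}
    (h : x ∈ C ∧ y ∈ C ∨ y ∈ C ∧ z ∈ C ∨ x ∈ C ∧ z ∈ C) : M.med x y z ∈ C := by
  rcases h with ⟨hx, hy⟩ | ⟨hy, hz⟩ | ⟨hx, hz⟩
  · exact hC.med_mem hx hy z
  · rw [M.med_rotate]
    exact hC.med_mem hy hz x
  · rw [M.med_swap_right]
    exact hC.med_mem hx hz y

lemma IsHalfspace.med_mem_iff {H : Set X} (hH : M.IsHalfspace H) (x y z : X) :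
    M.med x y z ∈ H ↔ x ∈ H ∧ y ∈ H ∨ y ∈ H ∧ z ∈ H ∨ x ∈ H ∧ z ∈ H := by
  refine ⟨fun h => ?_, hH.1.med_mem_of_two⟩
  by_contra hn
  have h' : M.med x y z ∈ Hᶜ := hH.2.med_mem_of_two (by
    simp only [Set.mem_compl_iff]
    tauto)
  exact h' h

lemma eq_of_forall_isHalfspace {x y : X} (h : ∀ H, M.IsHalfspace H → (x ∈ H ↔ y ∈ H)) :
    x = y := by
  by_contra hxy
  obtain ⟨H, hH, hx, hy⟩ := exists_isHalfspace_notMem_mem (M := M) hxy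
  exact hx ((h H hH).2 hy)

/-- Finitely many points of `[a, b]` have a join with respect to the basepoint `a`. -/
lemma exists_join {ι : Type*} (a b : X) (y : ι → X) (hy : ∀ i, y i ∈ M.interval a b)
    (S : Finset ι) : ∃ g, ∀ H, M.IsHalfspace H →
      (¬(g ∈ H ↔ a ∈ H) ↔ ∃ i ∈ S, ¬(y i ∈ H ↔ a ∈ H)) := by
  classical
  induction S using Finset.induction_on with
  | empty => exact ⟨a, by simp⟩
  | insert i S _ ih =>
    obtain ⟨g, hg⟩ := ih
    refine ⟨M.med b g (y i), fun H hH => ?_⟩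
    have hS : (∃ j ∈ S, ¬(y j ∈ H ↔ a ∈ H)) → ¬(b ∈ H ↔ a ∈ H) := by
      rintro ⟨j, -, hj⟩
      have h := hH.med_mem_iff a b (y j)
      rw [show M.med a b (y j) = y j from hy j] at h
      tauto
    have hi := hH.med_mem_iff a b (y i)
    rw [show M.med a b (y i) = y i from hy i] at hi
    rw [← hg H hH] at hS
    simp only [Finset.mem_insert, exists_eq_or_imp, ← hg H hH, hH.med_mem_iff]
    tauto

end MedianStruct

lemma boolMed_eq_true_iff (a b c : Bool) :
    boolMed a b c = true ↔ a = true ∧ b = true ∨ b = true ∧ c = true ∨ a = true ∧ c = true := by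
  revert a b c
  decide

/-- A predicate on the cube is a median homomorphism if it is negated exactly when two
coordinates are marked or the vector is true at a marked coordinate. -/
lemma apply_boolCubeMed_iff_of_pairs {I : Type*} {g : (I → Bool) → Prop} {c : Prop} {d : I → Prop}
    (hg : ∀ ε, ¬(g ε ↔ c) ↔ ∃ i j, (i ≠ j ∨ ε i = true) ∧ d i ∧ d j) (ε δ η : I → Bool) :
    g ((boolCubeMed I).med ε δ η) ↔ g ε ∧ g δ ∨ g δ ∧ g η ∨ g ε ∧ g η := by
  have maj_self : ∀ p : Prop, p ↔ p ∧ p ∨ p ∧ p ∨ p ∧ p := fun p => by tauto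
  by_cases hne : ∃ i, d i
  · obtain ⟨i, hi⟩ := hne
    by_cases huniq : ∀ j, d j → j = i
    · have hgi : ∀ ε, g ε ↔ ¬(ε i = true ↔ c) := by
        intro ε
        have h : (∃ j k, (j ≠ k ∨ ε j = true) ∧ d j ∧ d k) ↔ ε i = true := by
          refine ⟨?_, fun h => ⟨i, i, Or.inr h, hi, hi⟩⟩
          rintro ⟨j, k, h, hj, hk⟩
          rw [huniq j hj, huniq k hk] at h
          simpa using h
        rw [← h, ← hg]
        tauto
      have hm := boolMed_eq_true_iff (ε i) (δ i) (η i)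
      simp only [hgi]
      change ¬(boolMed (ε i) (δ i) (η i) = true ↔ c) ↔ _
      rw [hm]
      by_cases c <;> grind only
    · push Not at huniq
      obtain ⟨j, hj, hji⟩ := huniq
      have hall : ∀ ε, g ε ↔ ¬c := fun ε => by
        have := (hg ε).2 ⟨j, i, Or.inl hji, hj, hi⟩
        tauto
      simpa only [hall] using maj_self (¬c)
  · have hnone : ∀ ε, g ε ↔ c := fun ε =>
      not_not.1 fun h => let ⟨i, _, _, hi, _⟩ := (hg ε).1 h; hne ⟨i, hi⟩
    simpa only [hnone] using maj_self c

section

variable {X : Type*} {M : MedianStruct X} {n : ℕ}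

/-- The preimages of suitable halfspaces under an embedded cube are the coordinate halfspaces. -/
lemma exists_isHalfspace_mem_iff_apply {f : (Fin n → Bool) → X} (hf : Function.Injective f)
    (hM : IsMedianHom (boolCubeMed (Fin n)) M f) (i : Fin n) :
    ∃ H, M.IsHalfspace H ∧ ∀ x, f x ∈ H ↔ x i = true := by
  set e : Fin n → Bool := fun j => decide (j = i) with he
  have hne : (fun _ => false) ≠ e := fun h => by simpa [he] using congrFun h i
  obtain ⟨H, hH, h₀, h₁⟩ :=
    MedianStruct.exists_isHalfspace_notMem_mem (M := M) (hf.ne hne)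
  refine ⟨H, hH, fun x => ?_⟩
  by_cases hx : x i = true
  · have h : (boolCubeMed (Fin n)).med (fun _ => false) x e = e := by
      funext j
      by_cases hj : j = i
      · subst hj
        simp [boolCubeMed, boolMed, he, hx]
      · simp [boolCubeMed, boolMed, he, hj]
    have h' := hM (fun _ => false) x e
    rw [h] at h'
    rw [h', hH.med_mem_iff] at h₁
    tauto
  · have h : (boolCubeMed (Fin n)).med e x (fun _ => false) = fun _ => false := by
      funext j
      by_cases hj : j = i
      · subst hj
        simp [boolCubeMed, boolMed, hx]
      · simp [boolCubeMed, boolMed, he, hj]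
    have h' := hM e x (fun _ => false)
    rw [h] at h'
    rw [h', hH.med_mem_iff] at h₀
    tauto

lemma exists_indepSetFamily_of_isMedianHom {f : (Fin n → Bool) → X} (hf : Function.Injective f)
    (hM : IsMedianHom (boolCubeMed (Fin n)) M f) :
    ∃ A : Fin n → Set X, (∀ i, A i ∈ {H | M.IsHalfspace H}) ∧ Function.Injective A ∧
      IndepSetFamily A := by
  choose A hA hAf using exists_isHalfspace_mem_iff_apply hf hM
  refine ⟨A, hA, fun i j hij => ?_, fun P Q hPQ => ⟨f fun i => decide (i ∈ P), ?_, ?_⟩⟩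
  · have h : f (fun k => decide (k = i)) ∈ A i := by simp [hAf]
    rw [hij, hAf] at h
    simpa [eq_comm] using h
  · simp [hAf]
  · simpa [hAf] using fun i hi hi' => Finset.disjoint_left.1 hPQ hi' hi

lemma exists_isMedianHom_of_indepSetFamily {A : Fin n → Set X} (hA : ∀ i, M.IsHalfspace (A i))
    (hind : IndepSetFamily A) :
    ∃ f : (Fin n → Bool) → X, Function.Injective f ∧ IsMedianHom (boolCubeMed (Fin n)) M f := by
  classical
  have hpt : ∀ P : Finset (Fin n), ∃ x, ∀ i, x ∈ A i ↔ i ∈ P := by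
    intro P
    obtain ⟨x, hx, hx'⟩ := hind P Pᶜ disjoint_compl_right
    simp only [Set.mem_iInter, Finset.mem_compl, Set.mem_compl_iff] at hx hx'
    exact ⟨x, fun i => ⟨fun h => by_contra fun hi => hx' i hi h, hx i⟩⟩
  obtain ⟨a, ha⟩ := hpt ∅
  obtain ⟨b, hb⟩ := hpt Finset.univ
  choose p hp using fun i => hpt {i}
  set x : Fin n → X := fun i => M.med a b (p i) with hxdef
  have hx : ∀ i, M.med a b (x i) = x i := fun i => M.med_mem_interval a b (p i)
  have hxA : ∀ i k, x i ∈ A k ↔ k = i := fun i k => by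
    simp [hxdef, (hA k).med_mem_iff, ha, hb, hp]
  have hpair : ∀ q : Fin n × Fin n, M.med a (x q.1) (x q.2) ∈ M.interval a b := by
    refine fun q => MedianStruct.eq_of_forall_isHalfspace (M := M) fun H hH => ?_
    have h₁ := hH.med_mem_iff a b (x q.1)
    have h₂ := hH.med_mem_iff a b (x q.2)
    rw [hx] at h₁ h₂
    simp only [hH.med_mem_iff]
    tauto
  choose f hf using fun ε : Fin n → Bool => MedianStruct.exists_join a b
    (fun q : Fin n × Fin n => M.med a (x q.1) (x q.2)) hpair
    (Finset.univ.filter fun q => q.1 ≠ q.2 ∨ ε q.1 = true)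
  have hf' : ∀ ε H, M.IsHalfspace H → (¬(f ε ∈ H ↔ a ∈ H) ↔ ∃ i j, (i ≠ j ∨ ε i = true) ∧
      ¬(x i ∈ H ↔ a ∈ H) ∧ ¬(x j ∈ H ↔ a ∈ H)) := by
    intro ε H hH
    rw [hf ε H hH]
    simp only [Finset.mem_filter, Finset.mem_univ, true_and, Prod.exists, hH.med_mem_iff]
    refine exists_congr fun i => exists_congr fun j => and_congr_right fun _ => ?_
    tauto
  refine ⟨f, fun ε δ h => ?_, fun ε δ η => ?_⟩
  · have hfA : ∀ ε k, f ε ∈ A k ↔ ε k = true := fun ε k => by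
      have := hf' ε (A k) (hA k)
      simp only [ha, hxA, Finset.notMem_empty, iff_false, not_not] at this
      rw [this]
      refine ⟨?_, fun hk => ⟨k, k, Or.inr hk, rfl, rfl⟩⟩
      rintro ⟨i, j, hij, rfl, rfl⟩
      simpa using hij
    funext k
    rw [Bool.eq_iff_iff, ← hfA, ← hfA, h]
  · refine MedianStruct.eq_of_forall_isHalfspace (M := M) fun H hH => ?_
    rw [hH.med_mem_iff]
    exact apply_boolCubeMed_iff_of_pairs (fun ε => hf' ε H hH) ε δ η

end

/-- the independence number of the family of all halfspaces of a
median algebra equals its rank. -/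
theorem indSets_halfspaces_eq_medRank {X : Type*} (M : MedianStruct X) :
    indSets {H : Set X | M.IsHalfspace H} = medRank M := by
  refine iSup_congr fun n => iSup_congr_Prop ⟨?_, ?_⟩ fun _ => rfl
  · rintro ⟨A, hA, -, hind⟩
    exact exists_isMedianHom_of_indepSetFamily hA hind
  · rintro ⟨f, hf, hM⟩
    exact exists_indepSetFamily_of_isMedianHom hf hM
end

section
/- Let X be a median algebra and let f₁, …, f_k : X → ℝ be median-preserving maps forming an independent sequence with witnessing constants a < b. Then there exist halfspaces A₁, …, A_k of X such that f_i⁻¹((-∞,a]) ⊆ A_i and f_i⁻¹([b,∞)) ⊆ X \ A_i for every i, and {A₁, …, A_k} is an independent family of subsets of X. -/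
open Set

/-- Sublevel sets of real-valued median-preserving functions are halfspaces. -/
theorem IsMedianPreserving.isHalfspace_le {X : Type*} {M : MedianStruct X} {f : X → ℝ}
    (hf : IsMedianPreserving M f) (a : ℝ) : M.IsHalfspace {x | f x ≤ a} := by
  have key : ∀ x y z, z ∈ M.interval x y → realMed (f x) (f y) (f z) = f z := by
    intro x y z hz
    rw [← hf x y z, show M.med x y z = z from hz]
  refine ⟨fun x hx y hy z hz => ?_, fun x hx y hy z hz => ?_⟩
  · have h := key x y z hz
    simp only [mem_ofPred_eq] at hx hy ⊢
    rw [← h, realMed]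
    exact max_le (max_le (min_le_of_left_le hx) (min_le_of_left_le hy)) (min_le_of_left_le hx)
  · have h := key x y z hz
    simp only [mem_compl_iff, mem_ofPred_eq, not_le] at hx hy ⊢
    rw [← h, realMed]
    exact lt_max_of_lt_left (lt_max_of_lt_left (lt_min hx hy))

/-- from an independent finite sequence of median-preserving real
functions (with witnessing constants `a < b`) one obtains an independent family
of halfspaces separating the sublevel sets from the superlevel sets. -/
theorem exists_indep_halfspaces_of_indep_MP {X : Type*} (M : MedianStruct X)
    (k : ℕ) (f : Fin k → X → ℝ) (hf : ∀ i, IsMedianPreserving M (f i))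
    (a b : ℝ) (hab : a < b) (hind : IndepFunFinWith f a b) :
    ∃ A : Fin k → Set X, (∀ i, M.IsHalfspace (A i)) ∧
      (∀ i, {x | f i x ≤ a} ⊆ A i) ∧
      (∀ i, {x | b ≤ f i x} ⊆ (A i)ᶜ) ∧
      IndepSetFamily A := by
  refine ⟨fun i => {x | f i x ≤ a}, fun i => (hf i).isHalfspace_le a, fun i => Subset.rfl,
    fun i x hx => not_le.mpr (hab.trans_le hx), fun P N hPN => ?_⟩
  exact (hind P N hPN).mono (inter_subset_inter_right _
    (iInter₂_mono fun j _ x hx => not_le.mpr (hab.trans_le hx)))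
end

section
/- There exists a median algebra X such that for every n ∈ ℕ there is an injective median-preserving map from the Boolean hypercube {0,1}ⁿ into X (so rank(X) = ∞), and yet every family of pairwise crossing halfspaces of X is finite (X has subinfinite rank). -/
open Set

/-- `x` lies in the `n`-th block of coordinates: it vanishes outside `{n} × {0, …, n - 1}`. -/
def InBlock (n : ℕ) (x : ℕ × ℕ → Bool) : Prop :=
  ∀ p, x p = true → p.1 = n ∧ p.2 < n

theorem InBlock.med {n₁ n₂ n₃ : ℕ} {x y z : ℕ × ℕ → Bool} (hx : InBlock n₁ x)
    (hy : InBlock n₂ y) (hz : InBlock n₃ z) :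
    InBlock (if n₂ = n₃ then n₂ else n₁) ((boolCubeMed (ℕ × ℕ)).med x y z) := by
  intro p hp
  have h1 := hx p
  have h2 := hy p
  have h3 := hz p
  simp only [boolCubeMed, boolMed, Bool.or_eq_true, Bool.and_eq_true] at hp
  split_ifs <;> grind

/-- The wedge of the cubes `{0,1}ⁿ`, `n : ℕ`, glued along their zero vectors. -/
def CubeWedge : Type := {x : ℕ × ℕ → Bool // ∃ n, InBlock n x}

namespace CubeWedge

/-- The coordinatewise median on the wedge of cubes. -/
def median : MedianStruct CubeWedge where
  med x y z := ⟨(boolCubeMed (ℕ × ℕ)).med x.1 y.1 z.1, by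
    obtain ⟨_, hx⟩ := x.2
    obtain ⟨_, hy⟩ := y.2
    obtain ⟨_, hz⟩ := z.2
    exact ⟨_, hx.med hy hz⟩⟩
  med_perm σ v := Subtype.ext ((boolCubeMed (ℕ × ℕ)).med_perm σ fun j => (v j).1)
  med_idem x y := Subtype.ext ((boolCubeMed (ℕ × ℕ)).med_idem x.1 y.1)
  med_assoc x y z u w :=
    Subtype.ext ((boolCubeMed (ℕ × ℕ)).med_assoc x.1 y.1 z.1 u.1 w.1)

/-- The common zero vector of all the cubes. -/
def base : CubeWedge := ⟨fun _ => false, 0, by simp [InBlock]⟩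

/-- The `n`-th cube of the wedge. -/
def block (n : ℕ) : Set CubeWedge := {x | InBlock n x.1}

theorem finite_block (n : ℕ) : (block n).Finite := by
  refine Set.Finite.of_finite_image (f := fun x (i : Fin n) => x.1 (n, i)) (Set.toFinite _) ?_
  intro x hx y hy h
  apply Subtype.ext
  funext p
  have h1 := hx p
  have h2 := hy p
  by_cases hp : p.1 = n ∧ p.2 < n
  · obtain ⟨a, b⟩ := p
    obtain ⟨rfl, hb⟩ := hp
    exact congrFun h ⟨b, hb⟩
  · rw [Bool.eq_false_of_not_eq_true (mt h1 hp), Bool.eq_false_of_not_eq_true (mt h2 hp)]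

/-- The inclusion of the `n`-cube in the wedge. -/
def ofCube (n : ℕ) (f : Fin n → Bool) : CubeWedge :=
  ⟨fun p => if h : p.1 = n ∧ p.2 < n then f ⟨p.2, h.2⟩ else false, n, by
    intro p hp
    by_contra h
    simp [h] at hp⟩

theorem ofCube_injective (n : ℕ) : Function.Injective (ofCube n) := by
  intro f g h
  funext i
  simpa [ofCube] using congrFun (congrArg Subtype.val h) (n, i)

theorem isMedianHom_ofCube (n : ℕ) : IsMedianHom (boolCubeMed (Fin n)) median (ofCube n) := by
  intro f g h
  apply Subtype.ext
  funext p
  by_cases hp : p.1 = n ∧ p.2 < n <;> simp [ofCube, median, boolCubeMed, boolMed, hp]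

theorem subset_block_of_isConvex {C : Set CubeWedge} (hC : median.IsConvex C) (h0 : base ∉ C)
    {n : ℕ} {x : CubeWedge} (hx : x ∈ C) (hxn : x ∈ block n) : C ⊆ block n := by
  intro y hy
  obtain ⟨m, hym⟩ := y.2
  obtain rfl | hnm := eq_or_ne m n
  · exact hym
  · refine absurd (hC x hx y hy ?_) h0
    apply Subtype.ext
    funext p
    have h1 := hxn p
    have h2 := hym p
    have h : ¬ (x.1 p = true ∧ y.1 p = true) := fun h =>
      hnm ((h2 h.2).1.symm.trans (h1 h.1).1)
    simpa [median, boolCubeMed, boolMed, base] using h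

open Classical in
/-- The one of `A`, `Aᶜ` that does not contain the base point. -/
def offBase (A : Set CubeWedge) : Set CubeWedge := if base ∈ A then Aᶜ else A

theorem base_notMem_offBase (A : Set CubeWedge) : base ∉ offBase A := by
  unfold offBase
  split_ifs with h <;> simpa using h

theorem isConvex_offBase {A : Set CubeWedge} (hA : median.IsHalfspace A) :
    median.IsConvex (offBase A) := by
  unfold offBase
  split_ifs
  exacts [hA.2, hA.1]

theorem offBase_inter_nonempty {A B : Set CubeWedge} (h : Crossing A B) :
    (offBase A ∩ offBase B).Nonempty := by
  obtain ⟨h1, h2, h3, h4⟩ := h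
  unfold offBase
  split_ifs <;> assumption

theorem exists_offBase_subset_block {A : Set CubeWedge} (hA : median.IsHalfspace A) :
    ∃ n, offBase A ⊆ block n := by
  obtain h | ⟨x, hx⟩ := (offBase A).eq_empty_or_nonempty
  · exact ⟨0, by simp [h]⟩
  · obtain ⟨n, hn⟩ := x.2
    exact ⟨n, subset_block_of_isConvex (isConvex_offBase hA) (base_notMem_offBase A) hx hn⟩

theorem finite_setOf_offBase_subset_block (n : ℕ) : {A | offBase A ⊆ block n}.Finite := by
  refine ((finite_block n).finite_subsets.union
    ((finite_block n).finite_subsets.image compl)).subset fun A hA => ?_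
  simp only [Set.mem_ofPred_eq, offBase] at hA
  split_ifs at hA
  · exact Or.inr ⟨Aᶜ, hA, compl_compl A⟩
  · exact Or.inl hA

theorem finite_of_pairwise_crossing {𝒜 : Set (Set CubeWedge)}
    (h𝒜 : ∀ A ∈ 𝒜, median.IsHalfspace A) (hcross : 𝒜.Pairwise Crossing) : 𝒜.Finite := by
  obtain rfl | ⟨A, hA⟩ := 𝒜.eq_empty_or_nonempty
  · exact Set.finite_empty
  obtain ⟨n, hn⟩ := exists_offBase_subset_block (h𝒜 A hA)
  refine (finite_setOf_offBase_subset_block n).subset fun B hB => ?_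
  obtain rfl | hne := eq_or_ne A B
  · exact hn
  · obtain ⟨x, hxA, hxB⟩ := offBase_inter_nonempty (hcross hA hB hne)
    exact subset_block_of_isConvex (isConvex_offBase (h𝒜 B hB)) (base_notMem_offBase B) hxB
      (hn hxA)

end CubeWedge

theorem medRank_eq_top {X : Type*} {M : MedianStruct X}
    (h : ∀ n : ℕ, ∃ f : (Fin n → Bool) → X,
      Function.Injective f ∧ IsMedianHom (boolCubeMed (Fin n)) M f) : medRank M = ⊤ :=
  ENat.eq_top_iff_forall_ge.2 fun n => le_iSup₂_of_le n (h n) le_rfl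

/-- there is a median algebra of infinite rank (every Boolean
hypercube embeds into it) in which every family of pairwise crossing
halfspaces is nevertheless finite (subinfinite rank). -/
theorem exists_subinfinite_rank_not_finite_rank :
    ∃ (X : Type) (M : MedianStruct X),
      (∀ n : ℕ, ∃ f : (Fin n → Bool) → X,
        Function.Injective f ∧ IsMedianHom (boolCubeMed (Fin n)) M f) ∧
      medRank M = ⊤ ∧
      (∀ 𝒜 : Set (Set X), (∀ A ∈ 𝒜, M.IsHalfspace A) →
        𝒜.Pairwise Crossing → 𝒜.Finite) := by
  have h : ∀ n : ℕ, ∃ f : (Fin n → Bool) → CubeWedge,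
      Function.Injective f ∧ IsMedianHom (boolCubeMed (Fin n)) CubeWedge.median f := fun n =>
    ⟨CubeWedge.ofCube n, CubeWedge.ofCube_injective n, CubeWedge.isMedianHom_ofCube n⟩
  exact ⟨CubeWedge, CubeWedge.median, h, medRank_eq_top h,
    fun _ => CubeWedge.finite_of_pairwise_crossing⟩
end
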